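/- (St. Dizier–Yong vanishing condition) Let u, v, w ∈ S_n. If the set of indicator tableaux Tab^w_{u,v} is empty, then the Schubert coefficient c^w_{u,v} = 0. -/

import Mathlib

open scoped Classical

/-- `w` lies in (the copy of) `S_n`: it fixes every point `m ≥ n` (0-indexed). -/
def InSymm (n : ℕ) (w : Equiv.Perm ℕ) : Prop := ∀ m, n ≤ m → w m = m

/-- `w ∈ S_∞`: `w` fixes all but finitely many points. -/
def IsFinPerm (w : Equiv.Perm ℕ) : Prop := ∃ n, InSymm n w

/-- `ℓ(w)`: the number of inversions of `w`. -/
noncomputable def invLen (w : Equiv.Perm ℕ) : ℕ :=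
  Set.ncard {p : ℕ × ℕ | p.1 < p.2 ∧ w p.2 < w p.1}

/-- the Lehmer code of `w` (0-indexed): `lCode w i = #{j > i | w j < w i}`. -/
noncomputable def lCode (w : Equiv.Perm ℕ) (i : ℕ) : ℕ :=
  Set.ncard {j | i < j ∧ w j < w i}

/-- the descent set of `w` (0-indexed). -/
def des (w : Equiv.Perm ℕ) : Set ℕ := {i | w (i + 1) < w i}

/-- the divided difference operator `∂ᵢ f = (f - sᵢ·f)/(xᵢ - xᵢ₊₁)`. -/
noncomputable def divDiff (i : ℕ) (f : MvPolynomial ℕ ℤ) : MvPolynomial ℕ ℤ :=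
  if h : ∃ g, f - MvPolynomial.rename (Equiv.swap i (i + 1)) f =
      (MvPolynomial.X i - MvPolynomial.X (i + 1)) * g
  then h.choose else 0

/-- `𝔖_{w₀} = x₁^{n-1} x₂^{n-2} ⋯ x_{n-1}` (with variables 0-indexed). -/
noncomputable def staircase (n : ℕ) : MvPolynomial ℕ ℤ :=
  ∏ i ∈ Finset.range n, (MvPolynomial.X i : MvPolynomial ℕ ℤ) ^ (n - 1 - i)

/-- Fuelled recursion computing Schubert polynomials inside `S_n`:
`𝔖_w = ∂ᵢ 𝔖_{w·sᵢ}` whenever `w i < w (i+1)`, starting from `𝔖_{w₀} = staircase n`. -/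
noncomputable def SchubertAux (n : ℕ) : ℕ → Equiv.Perm ℕ → MvPolynomial ℕ ℤ
  | 0, _ => staircase n
  | (k + 1), w =>
    if h : ∃ i, i + 1 < n ∧ w i < w (i + 1) then
      divDiff h.choose (SchubertAux n k (w * Equiv.swap h.choose (h.choose + 1)))
    else staircase n

/-- the Schubert polynomial `𝔖_w` of `w ∈ S_∞`. -/
noncomputable def Schubert (w : Equiv.Perm ℕ) : MvPolynomial ℕ ℤ :=
  if h : IsFinPerm w then SchubertAux h.choose (h.choose * h.choose) w else 0

/-- `c` is the family of Schubert coefficients `c^w_{u,v}` for the pair `(u,v)`, i.e. the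
(finitely supported, `S_∞`-supported) coefficients with
`𝔖_u · 𝔖_v = Σ_{w ∈ S_∞} c^w_{u,v} 𝔖_w`. -/
def IsSchubertCoeff (u v : Equiv.Perm ℕ) (c : Equiv.Perm ℕ →₀ ℕ) : Prop :=
  (∀ w ∈ c.support, IsFinPerm w) ∧
  Schubert u * Schubert v = c.sum fun w k => (k : MvPolynomial ℕ ℤ) * Schubert w

/-- `w'` is the code scaling `N ∗ w`: the unique permutation whose Lehmer code is
`N` times the Lehmer code of `w`. -/
def IsCodeScale (N : ℕ) (w w' : Equiv.Perm ℕ) : Prop :=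
  IsFinPerm w' ∧ ∀ i, lCode w' i = N * lCode w i

/-- the Rothe diagram of `w` (0-indexed). -/
def rothe (w : Equiv.Perm ℕ) : Set (ℕ × ℕ) := {p | p.2 < w p.1 ∧ p.1 < w.symm p.2}

/-- column `h` of the Rothe diagram of `w`. -/
def rotheCol (w : Equiv.Perm ℕ) (h : ℕ) : Set ℕ := {r | (r, h) ∈ rothe w}

/-- the shaded columns of `D(w)` with respect to `k`: the columns `w r` for rows `r > k`. -/
def shadedCols (k : ℕ) (w : Equiv.Perm ℕ) : Set ℕ := {j | ∃ r, k < r ∧ w r = j}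

/-- the position at which (the copies of) column `j` start after every shaded column
is replaced by `N` adjacent copies of itself. -/
noncomputable def stretchCol (k N : ℕ) (w : Equiv.Perm ℕ) (j : ℕ) : ℕ :=
  Set.ncard {h | h < j ∧ h ∉ shadedCols k w} + N * Set.ncard {h | h < j ∧ h ∈ shadedCols k w}

/-- `w'` is the bit scaling `N ⊗ w` with respect to `k`: the unique permutation in `S_∞`
whose Rothe diagram is obtained from `D(w)` by replacing each shaded column by `N`
adjacent copies of itself. -/
def IsBitScale (k N : ℕ) (w w' : Equiv.Perm ℕ) : Prop :=
  IsFinPerm w' ∧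
  rothe w' = {q | ∃ p ∈ rothe w, ∃ m,
    m < (if p.2 ∈ shadedCols k w then N else 1) ∧ q = (p.1, stretchCol k N w p.2 + m)}

/-- `D(u)` together with a copy of `D(v)` shifted `m` columns to the right. -/
def doubleDiagram (m : ℕ) (u v : Equiv.Perm ℕ) : Set (ℕ × ℕ) :=
  rothe u ∪ {q | ∃ p ∈ rothe v, q = (p.1, p.2 + m)}

/-- `T` is an indicator tableau in `Tab^w_{u,v}` (for `u, v, w ∈ S_m`, all 0-indexed):
a filling of `D(u) ∪ D(v)` with entries in `{0, …, m-1}` such that the number of entries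
equal to `i` is `lCode w i`, entries strictly increase down each column, and every entry
appearing in row `r` is at most `r`. -/
def IsIndicatorTableau (m : ℕ) (u v w : Equiv.Perm ℕ) (T : ℕ × ℕ → ℕ) : Prop :=
  (∀ p ∈ doubleDiagram m u v, T p < m) ∧
  (∀ i < m, Set.ncard {p | p ∈ doubleDiagram m u v ∧ T p = i} = lCode w i) ∧
  (∀ p ∈ doubleDiagram m u v, ∀ q ∈ doubleDiagram m u v, p.2 = q.2 → p.1 < q.1 → T p < T q) ∧
  (∀ p ∈ doubleDiagram m u v, T p ≤ p.1)

section NilCoxeter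

variable {K R : Type*} [CommRing K] [Ring R] [Algebra K R]

/-- The product `(1 + x u_{k+d-1}) ⋯ (1 + x u_{k+1}) (1 + x u_k)`. -/
def rowProd (u : ℕ → R) : ℕ → ℕ → K → R
  | _, 0, _ => 1
  | k, d + 1, x => rowProd u (k + 1) d x * (1 + x • u k)

/-- The relations of the nilCoxeter algebra. -/
structure IsNilCoxeter (u : ℕ → R) : Prop where
  sq : ∀ i, u i * u i = 0
  comm : ∀ i j, i + 2 ≤ j → u i * u j = u j * u i
  braid : ∀ i, u (i + 1) * u i * u (i + 1) = u i * u (i + 1) * u i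

variable {u : ℕ → R}

theorem IsNilCoxeter.commute_rowProd (hu : IsNilCoxeter u) (x : K) (i k d : ℕ) (h : i + 2 ≤ k) :
    Commute (u i) (rowProd u k d x) := by
  induction d generalizing k with
  | zero => exact Commute.one_right _
  | succ d ih =>
    refine (ih (k + 1) (by omega)).mul_right ?_
    refine (Commute.one_right _).add_right (Commute.smul_right ?_ x)
    exact hu.comm i k h

theorem IsNilCoxeter.one_add_mul_one_sub (hu : IsNilCoxeter u) (x : K) (i : ℕ) :
    (1 + x • u i) * (1 - x • u i) = 1 := by
  simp [mul_sub, add_mul, hu.sq]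

theorem IsNilCoxeter.rowProd_eq (hu : IsNilCoxeter u) (x : K) (k d : ℕ) :
    rowProd u (k + 1) d x = rowProd u k (d + 1) x * (1 - x • u k) := by
  rw [rowProd, mul_assoc, hu.one_add_mul_one_sub, mul_one]

/-- The local identity behind the commutation of rows. -/
theorem nilCoxeter_local {a b : R} (ha : a * a = 0) (hb : b * b = 0)
    (hab : a * b * a = b * a * b) (x y : K) :
    (1 - y • a) * (1 + x • b) * (1 + y • a) * (1 + y • b) =
      1 + (x + y) • b + (x * y) • (b * a - a * b) := by
  have h2 : a * (b * a) = b * (a * b) := by rw [← mul_assoc, hab, mul_assoc]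
  simp only [sub_mul, mul_add, add_mul, one_mul, mul_one, smul_mul_assoc, mul_smul_comm, ha, hb,
    mul_assoc, smul_zero, mul_zero, zero_mul, h2]
  module

theorem IsNilCoxeter.rowProd_comm (hu : IsNilCoxeter u) (k d : ℕ) (x y : K) :
    rowProd u k d x * rowProd u k d y = rowProd u k d y * rowProd u k d x := by
  induction d generalizing k with
  | zero => rfl
  | succ d ih =>
    cases d with
    | zero =>
      simp only [rowProd, one_mul, mul_add, add_mul, mul_one, smul_mul_smul_comm, hu.sq]
      simp only [smul_zero]
      abel
    | succ d =>
      have key : ∀ x y : K, rowProd u k (d + 2) x * rowProd u k (d + 2) y =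
          rowProd u (k + 1) (d + 1) x * rowProd u (k + 1) (d + 1) y *
            (1 + (x + y) • u k + (x * y) • (u k * u (k + 1) - u (k + 1) * u k)) := by
        intro x y
        have hc : (1 + x • u k) * rowProd u (k + 2) d y = rowProd u (k + 2) d y * (1 + x • u k) :=
          ((Commute.one_left _).add_left
            ((hu.commute_rowProd y k (k + 2) d le_rfl).smul_left x)).eq
        have e1 : ∀ z : K, rowProd u k (d + 2) z = rowProd u (k + 1) (d + 1) z * (1 + z • u k) :=
          fun z => rfl
        rw [← nilCoxeter_local (hu.sq (k + 1)) (hu.sq k) (hu.braid k), e1, e1]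
        calc _ = rowProd u (k + 1) (d + 1) x * ((1 + x • u k) * rowProd u (k + 2) d y) *
              (1 + y • u (k + 1)) * (1 + y • u k) := by
              simp only [rowProd, mul_assoc]
          _ = _ := by
              rw [hc, hu.rowProd_eq y (k + 1) d]
              simp only [mul_assoc]
      rw [key, key, ih, add_comm x y, mul_comm x y]

end NilCoxeter

section Operators

open Equiv MvPolynomial

/-- Left multiplication by the simple reflection `s_a` in the nilCoxeter algebra, acting on
coefficient functions. -/
noncomputable def leftOp (a : ℕ) :
    Module.End (MvPolynomial ℕ ℤ) (Perm ℕ → MvPolynomial ℕ ℤ) where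
  toFun f w := if w.symm (a + 1) < w.symm a then f (swap a (a + 1) * w) else 0
  map_add' f g := by ext1 w; simp only [Pi.add_apply]; split_ifs <;> simp
  map_smul' c f := by ext1 w; simp

/-- Right multiplication by the simple reflection `s_i` in the nilCoxeter algebra, acting on
coefficient functions. -/
noncomputable def rightOp (i : ℕ) :
    Module.End (MvPolynomial ℕ ℤ) (Perm ℕ → MvPolynomial ℕ ℤ) where
  toFun f w := if w (i + 1) < w i then f (w * swap i (i + 1)) else 0
  map_add' f g := by ext1 w; simp only [Pi.add_apply]; split_ifs <;> simp
  map_smul' c f := by ext1 w; simp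

theorem leftOp_apply (a : ℕ) (f : Perm ℕ → MvPolynomial ℕ ℤ) (w : Perm ℕ) :
    leftOp a f w = if w.symm (a + 1) < w.symm a then f (swap a (a + 1) * w) else 0 := rfl

theorem rightOp_apply (i : ℕ) (f : Perm ℕ → MvPolynomial ℕ ℤ) (w : Perm ℕ) :
    rightOp i f w = if w (i + 1) < w i then f (w * swap i (i + 1)) else 0 := rfl

theorem symm_swap_mul (a b : ℕ) (w : Perm ℕ) (x : ℕ) :
    (swap a b * w).symm x = w.symm (swap a b x) := rfl

theorem isNilCoxeter_leftOp : IsNilCoxeter leftOp where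
  sq i := by
    ext1 f; ext1 w
    simp only [Module.End.mul_apply, leftOp_apply, symm_swap_mul, swap_apply_left,
      swap_apply_right, LinearMap.zero_apply, Pi.zero_apply]
    split_ifs <;> first | rfl | omega
  comm i j h := by
    ext1 f; ext1 w
    have e1 : swap i (i + 1) j = j := swap_apply_of_ne_of_ne (by omega) (by omega)
    have e2 : swap i (i + 1) (j + 1) = j + 1 := swap_apply_of_ne_of_ne (by omega) (by omega)
    have e3 : swap j (j + 1) i = i := swap_apply_of_ne_of_ne (by omega) (by omega)
    have e4 : swap j (j + 1) (i + 1) = i + 1 := swap_apply_of_ne_of_ne (by omega) (by omega)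
    have e : swap j (j + 1) * (swap i (i + 1) * w) = swap i (i + 1) * (swap j (j + 1) * w) := by
      ext x
      simp only [Perm.mul_apply, swap_apply_def]
      split_ifs <;> omega
    simp only [Module.End.mul_apply, leftOp_apply, symm_swap_mul, e1, e2, e3, e4, e]
    split_ifs <;> rfl
  braid i := by
    ext1 f; ext1 w
    have e1 : swap i (i + 1) (i + 1 + 1) = i + 1 + 1 :=
      swap_apply_of_ne_of_ne (by omega) (by omega)
    have e2 : swap (i + 1) (i + 1 + 1) i = i := swap_apply_of_ne_of_ne (by omega) (by omega)
    have e : swap (i + 1) (i + 1 + 1) * (swap i (i + 1) * (swap (i + 1) (i + 1 + 1) * w)) =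
        swap i (i + 1) * (swap (i + 1) (i + 1 + 1) * (swap i (i + 1) * w)) := by
      ext x
      simp only [Perm.mul_apply, swap_apply_def]
      split_ifs <;> omega
    simp only [Module.End.mul_apply, leftOp_apply, symm_swap_mul, swap_apply_left,
      swap_apply_right, e1, e2, e]
    split_ifs <;> rfl

theorem commute_leftOp_rightOp (a i : ℕ) : Commute (leftOp a) (rightOp i) := by
  ext1 f; ext1 w
  simp only [Module.End.mul_apply, leftOp_apply, rightOp_apply, mul_assoc, Perm.mul_apply]
  have e : ∀ x, (w * swap i (i + 1)).symm x = swap i (i + 1) (w.symm x) := fun x => rfl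
  simp only [e]
  obtain ⟨p, hp⟩ : ∃ p, w.symm a = p := ⟨_, rfl⟩
  obtain ⟨q, hq⟩ : ∃ q, w.symm (a + 1) = q := ⟨_, rfl⟩
  rw [hp, hq]
  rw [symm_apply_eq] at hp hq
  have h1 : ∀ x, w x = a ↔ x = p := fun x => by rw [hp]; exact w.apply_eq_iff_eq
  have h2 : ∀ x, w x = a + 1 ↔ x = q := fun x => by rw [hq]; exact w.apply_eq_iff_eq
  have := h1 i
  have := h1 (i + 1)
  have := h2 i
  have := h2 (i + 1)
  simp only [swap_apply_def]
  split_ifs <;> first | rfl | omega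

/-- The coefficient function of the identity permutation. -/
noncomputable def deltaOne : Perm ℕ → MvPolynomial ℕ ℤ := fun w => if w = 1 then 1 else 0

theorem leftOp_deltaOne (i : ℕ) : leftOp i deltaOne = rightOp i deltaOne := by
  ext1 w
  simp only [leftOp_apply, rightOp_apply, deltaOne, mul_eq_one_iff_eq_inv, swap_inv]
  have h : swap i (i + 1) * w = 1 ↔ w = swap i (i + 1) := by
    rw [mul_eq_one_iff_inv_eq, swap_inv, eq_comm]
  by_cases hw : w = swap i (i + 1)
  · subst hw; simp [← Perm.inv_def]
  · have h2 : swap i (i + 1) ≠ w⁻¹ := by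
      intro h3; apply hw; rw [← inv_inv w, ← h3, swap_inv]
    simp [hw, h2]

/-- The operator whose value at `deltaOne` has the Schubert polynomials as coefficients. -/
noncomputable def pipeOp :
    ℕ → ℕ → Module.End (MvPolynomial ℕ ℤ) (Perm ℕ → MvPolynomial ℕ ℤ)
  | _, 0 => 1
  | k, d + 1 => rowProd leftOp k (d + 1) (X k : MvPolynomial ℕ ℤ) * pipeOp (k + 1) d

/-- The coefficients of the partial products. -/
noncomputable def pipeCoeff (k d : ℕ) : Perm ℕ → MvPolynomial ℕ ℤ := pipeOp k d deltaOne

theorem pipeCoeff_succ (k d : ℕ) : pipeCoeff k (d + 1) =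
    rowProd leftOp k (d + 1) (X k : MvPolynomial ℕ ℤ) (pipeCoeff (k + 1) d) := rfl

theorem pipeCoeff_eq (k d : ℕ) : pipeCoeff k d =
    rowProd leftOp k d (X k : MvPolynomial ℕ ℤ) (pipeCoeff (k + 1) (d - 1)) := by
  cases d <;> rfl

theorem commute_rowProd_rightOp (i k d : ℕ) (x : MvPolynomial ℕ ℤ) :
    Commute (rowProd leftOp k d x) (rightOp i) := by
  induction d generalizing k with
  | zero => exact Commute.one_left _
  | succ d ih =>
    exact (ih (k + 1)).mul_left
      ((Commute.one_left _).add_left ((commute_leftOp_rightOp k i).smul_left x))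

theorem leftOp_pipeCoeff (i k d : ℕ) (h : i + 2 ≤ k) :
    leftOp i (pipeCoeff k d) = rightOp i (pipeCoeff k d) := by
  induction d generalizing k with
  | zero => exact leftOp_deltaOne i
  | succ d ih =>
    have h1 := LinearMap.congr_fun
      (isNilCoxeter_leftOp.commute_rowProd (X k : MvPolynomial ℕ ℤ) i k (d + 1) h).eq
      (pipeCoeff (k + 1) d)
    have h2 := LinearMap.congr_fun
      (commute_rowProd_rightOp i k (d + 1) (X k : MvPolynomial ℕ ℤ)).eq (pipeCoeff (k + 1) d)
    simp only [Module.End.mul_apply] at h1 h2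
    rw [pipeCoeff_succ, h1, ← h2, ih (k + 1) (by omega)]

/-- Exchange of the variables `x_i` and `x_{i+1}`. -/
noncomputable def swapVars (i : ℕ) : MvPolynomial ℕ ℤ →ₐ[ℤ] MvPolynomial ℕ ℤ :=
  rename (swap i (i + 1))

theorem swapVars_rowProd (i k d : ℕ) (x : MvPolynomial ℕ ℤ) (f : Perm ℕ → MvPolynomial ℕ ℤ) :
    (fun w => swapVars i (rowProd leftOp k d x f w)) =
      rowProd leftOp k d (swapVars i x) (fun w => swapVars i (f w)) := by
  induction d generalizing k f with
  | zero => rfl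
  | succ d ih =>
    simp only [rowProd, Module.End.mul_apply]
    rw [ih]
    congr 1
    ext1 w
    simp only [LinearMap.add_apply, Module.End.one_apply, LinearMap.smul_apply, Pi.add_apply,
      Pi.smul_apply, smul_eq_mul, map_add, map_mul, leftOp_apply]
    split_ifs <;> simp

theorem swapVars_X_of_ne (i k : ℕ) (h1 : k ≠ i) (h2 : k ≠ i + 1) :
    swapVars i (X k) = X k := by
  rw [swapVars, rename_X, swap_apply_of_ne_of_ne h1 h2]

theorem swapVars_pipeCoeff_of_lt (i k d : ℕ) (h : i + 2 ≤ k) :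
    (fun w => swapVars i (pipeCoeff k d w)) = pipeCoeff k d := by
  induction d generalizing k with
  | zero =>
    ext1 w
    simp only [pipeCoeff, pipeOp, Module.End.one_apply, deltaOne]
    split_ifs <;> simp
  | succ d ih =>
    rw [pipeCoeff_succ, swapVars_rowProd, ih (k + 1) (by omega),
      swapVars_X_of_ne i k (by omega) (by omega)]

theorem pipeCoeff_sub_swapVars_self (i d : ℕ) :
    pipeCoeff i (d + 1) - (fun w => swapVars i (pipeCoeff i (d + 1) w)) =
      (X i - X (i + 1) : MvPolynomial ℕ ℤ) • rightOp i (pipeCoeff i (d + 1)) := by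
  set x : MvPolynomial ℕ ℤ := X i
  set y : MvPolynomial ℕ ℤ := X (i + 1)
  set g := pipeCoeff (i + 2) (d - 1)
  have hx : swapVars i x = y := by simp [swapVars, x, y]
  have hy : swapVars i y = x := by simp [swapVars, x, y]
  have hg : (fun w => swapVars i (g w)) = g := swapVars_pipeCoeff_of_lt i _ _ le_rfl
  have h0 := isNilCoxeter_leftOp
  have h1 : ∀ z t : MvPolynomial ℕ ℤ,
      rowProd leftOp i (d + 1) z (rowProd leftOp (i + 1) d t g) =
      (rowProd leftOp i (d + 1) z * rowProd leftOp i (d + 1) t) (g - t • leftOp i g) := by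
    intro z t
    rw [h0.rowProd_eq, Module.End.mul_apply, Module.End.mul_apply]
    rfl
  have h2 : rowProd leftOp (i + 1) d y (leftOp i g) =
      rowProd leftOp i (d + 1) y (leftOp i g) := by
    rw [h0.rowProd_eq, Module.End.mul_apply]
    congr 1
    have := LinearMap.congr_fun (h0.sq i) g
    simp only [Module.End.mul_apply, LinearMap.zero_apply] at this
    simp [this]
  have h3 : rightOp i (rowProd leftOp i (d + 1) x (rowProd leftOp (i + 1) d y g)) =
      rowProd leftOp i (d + 1) x (rowProd leftOp i (d + 1) y (leftOp i g)) := by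
    have h4 := LinearMap.congr_fun (commute_rowProd_rightOp i i (d + 1) x).eq
      (rowProd leftOp (i + 1) d y g)
    have h5 := LinearMap.congr_fun (commute_rowProd_rightOp i (i + 1) d y).eq g
    simp only [Module.End.mul_apply] at h4 h5
    rw [← h4, ← h5, ← leftOp_pipeCoeff i _ _ le_rfl, h2]
  have h6 : g - y • leftOp i g - (g - x • leftOp i g) = (x - y) • leftOp i g := by module
  rw [pipeCoeff_succ, swapVars_rowProd, pipeCoeff_eq (i + 1), swapVars_rowProd, hg, hx, hy, h3,
    h1, h1, h0.rowProd_comm i (d + 1) y x, ← map_sub, Module.End.mul_apply, h6, map_smul,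
    map_smul]

theorem pipeCoeff_sub_swapVars (i k d : ℕ) (hk : k ≤ i) (hi : i < k + d) :
    pipeCoeff k d - (fun w => swapVars i (pipeCoeff k d w)) =
      (X i - X (i + 1) : MvPolynomial ℕ ℤ) • rightOp i (pipeCoeff k d) := by
  induction d generalizing k with
  | zero => omega
  | succ d ih =>
    rcases hk.eq_or_lt with rfl | hk
    · exact pipeCoeff_sub_swapVars_self _ _
    · have h4 := LinearMap.congr_fun (commute_rowProd_rightOp i k (d + 1) (X k)).eq
        (pipeCoeff (k + 1) d)
      simp only [Module.End.mul_apply] at h4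
      rw [pipeCoeff_succ, swapVars_rowProd, swapVars_X_of_ne i k (by omega) (by omega), ← map_sub,
        ih (k + 1) hk (by omega), map_smul, h4]

theorem divDiff_eq_of_mul_eq (i : ℕ) (f g : MvPolynomial ℕ ℤ)
    (h : f - rename (swap i (i + 1)) f = (X i - X (i + 1)) * g) : divDiff i f = g := by
  have hex : ∃ g, f - rename (swap i (i + 1)) f = (X i - X (i + 1)) * g := ⟨g, h⟩
  rw [divDiff, dif_pos hex]
  have hne : (X i - X (i + 1) : MvPolynomial ℕ ℤ) ≠ 0 := by
    rw [sub_ne_zero]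
    intro h
    have := X_injective h
    omega
  exact mul_left_cancel₀ hne (hex.choose_spec.symm.trans h)

theorem divDiff_pipeCoeff (m i : ℕ) (hi : i < m) (w : Perm ℕ) (hw : w i < w (i + 1)) :
    divDiff i (pipeCoeff 0 m (w * swap i (i + 1))) = pipeCoeff 0 m w := by
  apply divDiff_eq_of_mul_eq
  have h := congr_fun (pipeCoeff_sub_swapVars i 0 m (Nat.zero_le _) (by omega))
    (w * swap i (i + 1))
  simp only [Pi.sub_apply, Pi.smul_apply, smul_eq_mul, rightOp_apply, mul_assoc, swap_mul_self,
    mul_one, Perm.mul_apply, swap_apply_left, swap_apply_right, if_pos hw] at h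
  exact h

end Operators

section LeadingTerm

open Equiv MvPolynomial

theorem finite_inversions (w : Perm ℕ) (i c : ℕ) : {j | i < j ∧ w j < c}.Finite :=
  ((Set.finite_Iio c).preimage w.injective.injOn).subset fun _ hj => hj.2

theorem lCode_eq_zero (w : Perm ℕ) (k : ℕ) (h : ∀ j ≤ k, w j = j) : lCode w k = 0 := by
  have : {j | k < j ∧ w j < w k} = ∅ := by
    rw [Set.eq_empty_iff_forall_notMem]
    rintro j ⟨h1, h2⟩
    rw [h k le_rfl] at h2
    have := w.injective (h _ h2.le)
    omega
  rw [lCode, this, Set.ncard_empty]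

theorem lCode_of_swap (w : Perm ℕ) (a : ℕ) (h : w.symm (a + 1) < w.symm a) (i : ℕ) :
    lCode w i = lCode (swap a (a + 1) * w) i + if i = w.symm (a + 1) then 1 else 0 := by
  obtain ⟨p, hp⟩ : ∃ p, w.symm (a + 1) = p := ⟨_, rfl⟩
  obtain ⟨q, hq⟩ : ∃ q, w.symm a = q := ⟨_, rfl⟩
  rw [hp, hq] at h
  rw [hp]
  rw [symm_apply_eq] at hp hq
  have h1 : ∀ x, w x = a ↔ x = q := fun x => by rw [hq]; exact w.apply_eq_iff_eq
  have h2 : ∀ x, w x = a + 1 ↔ x = p := fun x => by rw [hp]; exact w.apply_eq_iff_eq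
  have h3 := h1 i
  have h4 := h2 i
  unfold lCode
  split_ifs with hip
  · subst hip
    have : {j | i < j ∧ w j < w i} =
        insert q {j | i < j ∧ (swap a (a + 1) * w) j < (swap a (a + 1) * w) i} := by
      ext j
      have h5 := h1 j
      have h6 := h2 j
      simp only [Set.mem_ofPred_eq, Set.mem_insert_iff, Perm.mul_apply, swap_apply_def]
      split_ifs <;> omega
    rw [this, Set.ncard_insert_of_notMem _ (finite_inversions _ _ _)]
    simp [← hp, ← hq]
  · rw [add_zero]
    congr 1
    ext j
    have h5 := h1 j
    have h6 := h2 j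
    simp only [Set.mem_ofPred_eq, Perm.mul_apply, swap_apply_def]
    split_ifs <;> omega

theorem rowProd_succ_apply (k d : ℕ) (x : MvPolynomial ℕ ℤ) (g : Perm ℕ → MvPolynomial ℕ ℤ) :
    rowProd leftOp k (d + 1) x g = rowProd leftOp (k + 1) d x (g + x • leftOp k g) := rfl

theorem rowProd_induction (C : ℕ → (Perm ℕ → MvPolynomial ℕ ℤ) → Prop) (k d : ℕ)
    (x : MvPolynomial ℕ ℤ)
    (h : ∀ a, k ≤ a → a < k + d → ∀ g, C a g → C (a + 1) (g + x • leftOp a g))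
    (g : Perm ℕ → MvPolynomial ℕ ℤ) (hg : C k g) : C (k + d) (rowProd leftOp k d x g) := by
  induction d generalizing k g with
  | zero => exact hg
  | succ d ih =>
    rw [rowProd_succ_apply, show k + (d + 1) = k + 1 + d by omega]
    exact ih (k + 1) (fun a h1 h2 => h a (by omega) (by omega)) _
      (h k le_rfl (by omega) g hg)

theorem rowProd_add (k c e : ℕ) (x : MvPolynomial ℕ ℤ) (g : Perm ℕ → MvPolynomial ℕ ℤ) :
    rowProd leftOp k (c + e) x g = rowProd leftOp (k + c) e x (rowProd leftOp k c x g) := by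
  induction c generalizing k g with
  | zero => simp [rowProd]
  | succ c ih =>
    rw [show c + 1 + e = c + e + 1 by omega, rowProd_succ_apply, rowProd_succ_apply, ih,
      show k + 1 + c = k + (c + 1) by omega]

theorem add_smul_leftOp_ne_zero {a : ℕ} {x : MvPolynomial ℕ ℤ} {g : Perm ℕ → MvPolynomial ℕ ℤ}
    {w : Perm ℕ} (h : (g + x • leftOp a g) w ≠ 0) : g w ≠ 0 ∨ g (swap a (a + 1) * w) ≠ 0 := by
  by_contra! hc
  apply h
  simp [leftOp_apply, hc.1, hc.2]

theorem rowProd_support (k d p j : ℕ) (x : MvPolynomial ℕ ℤ) (g : Perm ℕ → MvPolynomial ℕ ℤ)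
    (hj : j < k) (hg : ∀ w, g w ≠ 0 → w p = j) (w : Perm ℕ)
    (hw : rowProd leftOp k d x g w ≠ 0) : w p = j := by
  refine rowProd_induction (fun _ g => ∀ w : Perm ℕ, g w ≠ 0 → w p = j) k d x ?_ g hg w hw
  intro a h1 _ g hg w hw
  rcases add_smul_leftOp_ne_zero hw with h | h
  · exact hg w h
  · have := hg _ h
    rw [Perm.mul_apply, ← eq_symm_apply, symm_swap] at this
    rw [this, swap_apply_of_ne_of_ne (by omega) (by omega)]

theorem pipeCoeff_support (k d j : ℕ) (hj : j < k) (w : Perm ℕ) (hw : pipeCoeff k d w ≠ 0) :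
    w j = j := by
  induction d generalizing k w with
  | zero =>
    have : w = 1 := by
      by_contra h
      exact hw (if_neg h)
    simp [this]
  | succ d ih =>
    exact rowProd_support k (d + 1) j j _ _ hj (fun w hw => ih (k + 1) (by omega) w hw) w hw

theorem rowProd_apply_of_last (k d p : ℕ) (x : MvPolynomial ℕ ℤ)
    (g : Perm ℕ → MvPolynomial ℕ ℤ) (hg : ∀ w, g w ≠ 0 → w p = k) (w : Perm ℕ)
    (hw : w p = k + d) (hlt : ∀ j < d, p < w.symm (k + j)) :
    ∃ w' : Perm ℕ, rowProd leftOp k d x g w = x ^ d * g w' ∧ w' p = k ∧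
      (∀ i, lCode w i = lCode w' i + if i = p then d else 0) ∧
      ∀ j, w j < k ∨ k + d < w j → w' j = w j := by
  induction d generalizing k g with
  | zero => exact ⟨w, by simp [rowProd], by simpa using hw, by simp, fun _ _ => rfl⟩
  | succ d ih =>
    have h1 : rowProd leftOp (k + 1) d x g w = 0 := by
      by_contra h
      have := rowProd_support (k + 1) d p k x g (by omega) hg w h
      omega
    have h2 : ∀ w, leftOp k g w ≠ 0 → w p = k + 1 := by
      intro w hw
      rw [leftOp_apply] at hw
      have := hg (swap k (k + 1) * w) (fun h => hw (by rw [h, ite_self]))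
      rw [Perm.mul_apply, ← eq_symm_apply, symm_swap, swap_apply_left] at this
      exact this
    obtain ⟨w', h3, h4, h5, h6⟩ := ih (k + 1) (leftOp k g) h2 (by omega) (fun j hj => by
      rw [show k + 1 + j = k + (j + 1) by omega]; exact hlt _ (by omega))
    have h7 : w'.symm (k + 1) = p := by rw [symm_apply_eq, h4]
    have h8 : w'.symm k = w.symm k := by
      rw [symm_apply_eq, h6 _ (Or.inl (by simp)), apply_symm_apply]
    have h9 : w'.symm (k + 1) < w'.symm k := by
      rw [h7, h8]; exact hlt 0 (by omega)
    refine ⟨swap k (k + 1) * w', ?_, ?_, ?_, ?_⟩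
    · rw [rowProd_succ_apply, map_add, map_smul, Pi.add_apply, h1, Pi.smul_apply, h3,
        leftOp_apply, if_pos h9, smul_eq_mul]
      ring
    · rw [Perm.mul_apply, h4, swap_apply_right]
    · intro i
      rw [h5, lCode_of_swap w' k h9, h7]
      split_ifs <;> omega
    · intro j hj
      rw [Perm.mul_apply, h6 j (by omega), swap_apply_of_ne_of_ne (by omega) (by omega)]

theorem exists_first_row (k d : ℕ) (w : Perm ℕ) (h1 : ∀ j < k, w j = j)
    (h2 : ∀ j, k + d < j → w j = j) :
    ∃ c ≤ d, lCode w k = c ∧ ∀ (x : MvPolynomial ℕ ℤ) (e : ℕ), ∃ w' : Perm ℕ,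
      rowProd leftOp k c x (pipeCoeff (k + 1) e) w = x ^ c * pipeCoeff (k + 1) e w' ∧
      (∀ i, lCode w i = lCode w' i + if i = k then c else 0) ∧
      (∀ j < k + 1, w' j = j) ∧ ∀ j, k + d < j → w' j = j := by
  have h3 : k ≤ w k := by
    by_contra! h
    have := w.injective (h1 _ h)
    omega
  have h4 : w k ≤ k + d := by
    by_contra! h
    have := w.injective (h2 _ h)
    omega
  obtain ⟨c, hc⟩ := Nat.exists_eq_add_of_le h3
  have main : ∀ (x : MvPolynomial ℕ ℤ) (e : ℕ), ∃ w' : Perm ℕ,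
      rowProd leftOp k c x (pipeCoeff (k + 1) e) w = x ^ c * pipeCoeff (k + 1) e w' ∧
      (∀ i, lCode w i = lCode w' i + if i = k then c else 0) ∧
      (∀ j < k + 1, w' j = j) ∧ ∀ j, k + d < j → w' j = j := by
    intro x e
    obtain ⟨w', h5, h6, h7, h8⟩ := rowProd_apply_of_last k c k x (pipeCoeff (k + 1) e)
      (fun w hw => pipeCoeff_support (k + 1) e k (by omega) w hw) w hc (by
        intro j hj
        obtain ⟨y, hy⟩ : ∃ y, w.symm (k + j) = y := ⟨_, rfl⟩
        rw [hy]
        rw [symm_apply_eq] at hy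
        by_contra! hle
        rcases hle.lt_or_eq with hlt | rfl
        · have := h1 y hlt
          omega
        · omega)
    refine ⟨w', h5, h7, ?_, ?_⟩
    · intro j hj
      rcases Nat.lt_succ_iff_lt_or_eq.1 hj with hlt | rfl
      · rw [h8 j (Or.inl (by rw [h1 j hlt]; exact hlt)), h1 j hlt]
      · exact h6
    · intro j hj
      have := h2 j hj
      rw [h8 j (Or.inr (by omega)), this]
  refine ⟨c, by omega, ?_, main⟩
  obtain ⟨w', -, h7, h8, -⟩ := main 0 0
  rw [h7, lCode_eq_zero w' k (fun j hj => h8 j (by omega)), if_pos rfl, zero_add]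

theorem eq_one_of_fixes (k : ℕ) (w : Perm ℕ) (h1 : ∀ j < k, w j = j)
    (h2 : ∀ j, k < j → w j = j) : w = 1 := by
  have hk : w k = k := by
    by_contra h
    rcases lt_or_gt_of_ne h with h | h
    · exact h.ne (w.injective (h1 _ h))
    · exact h.ne' (w.injective (h2 _ h))
  ext j
  rcases lt_trichotomy j k with h | rfl | h
  · exact h1 j h
  · exact hk
  · exact h2 j h

theorem lCode_one (i : ℕ) : lCode 1 i = 0 := lCode_eq_zero 1 i fun _ _ => rfl

theorem pipeCoeff_zero_one (k : ℕ) : pipeCoeff k 0 1 = 1 := if_pos rfl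

theorem pipeCoeff_eq_prod (k d : ℕ) (w : Perm ℕ) (h1 : ∀ j < k, w j = j)
    (h2 : ∀ j, k + d < j → w j = j) (h : ∀ i ≤ d, lCode w (k + i) = d - i) :
    pipeCoeff k d w = ∏ i ∈ Finset.range (d + 1), X (k + i) ^ (d - i) := by
  induction d generalizing k w with
  | zero =>
    rw [eq_one_of_fixes k w h1 h2]
    simp [pipeCoeff_zero_one]
  | succ d ih =>
    obtain ⟨c, -, hc2, hc3⟩ := exists_first_row k (d + 1) w h1 h2
    obtain rfl : d + 1 = c := by rw [← hc2]; exact (h 0 (Nat.zero_le _)).symm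
    obtain ⟨w', h5, h6, h7, h8⟩ := hc3 (X k) d
    rw [pipeCoeff_succ, h5, Finset.prod_range_succ', mul_comm]
    congr 1
    rw [ih (k + 1) w' h7 (fun j hj => h8 j (by omega)) (fun i hi => ?_)]
    · refine Finset.prod_congr rfl fun i _ => ?_
      rw [show k + 1 + i = k + (i + 1) by omega, show d + 1 - (i + 1) = d - i by omega]
    · have := h6 (k + 1 + i)
      rw [if_neg (by omega), add_zero] at this
      rw [← this, show k + 1 + i = k + (i + 1) by omega, h _ (by omega)]
      omega

theorem coeff_smul_leftOp_nonneg (k b : ℕ) (g : Perm ℕ → MvPolynomial ℕ ℤ)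
    (hg : ∀ w a, 0 ≤ (g w).coeff a) (w : Perm ℕ) (a : ℕ →₀ ℕ) :
    0 ≤ (((X k : MvPolynomial ℕ ℤ) • leftOp b g) w).coeff a := by
  rw [Pi.smul_apply, smul_eq_mul, coeff_X_mul', leftOp_apply]
  split_ifs <;> simp [hg]

theorem coeff_le_coeff_rowProd (k b d : ℕ) (g : Perm ℕ → MvPolynomial ℕ ℤ)
    (hg : ∀ w a, 0 ≤ (g w).coeff a) (w : Perm ℕ) (a : ℕ →₀ ℕ) :
    (g w).coeff a ≤ (rowProd leftOp b d (X k : MvPolynomial ℕ ℤ) g w).coeff a := by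
  refine rowProd_induction (fun _ g' => ∀ w a, 0 ≤ (g' w).coeff a ∧
    (g w).coeff a ≤ (g' w).coeff a) b d (X k) ?_ g (fun w a => ⟨hg w a, le_rfl⟩) w a |>.2
  intro c _ _ g' hg' w a
  have := coeff_smul_leftOp_nonneg k c g' (fun w a => (hg' w a).1) w a
  have := hg' w a
  rw [Pi.add_apply, coeff_add]
  constructor <;> linarith

theorem pipeCoeff_nonneg (k d : ℕ) (w : Perm ℕ) (a : ℕ →₀ ℕ) :
    0 ≤ (pipeCoeff k d w).coeff a := by
  induction d generalizing k w a with
  | zero =>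
    simp only [pipeCoeff, pipeOp, Module.End.one_apply, deltaOne]
    split_ifs
    · rw [coeff_one]; split_ifs <;> simp
    · simp
  | succ d ih => exact (ih _ _ _).trans (coeff_le_coeff_rowProd k k (d + 1) _ (ih _) w a)

theorem coeff_rowProd_nonneg (k b d : ℕ) (g : Perm ℕ → MvPolynomial ℕ ℤ)
    (hg : ∀ w a, 0 ≤ (g w).coeff a) (w : Perm ℕ) (a : ℕ →₀ ℕ) :
    0 ≤ (rowProd leftOp b d (X k : MvPolynomial ℕ ℤ) g w).coeff a :=
  (hg w a).trans (coeff_le_coeff_rowProd k b d g hg w a)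

theorem exists_coeff_lCode_pos (k d : ℕ) (w : Perm ℕ) (h1 : ∀ j < k, w j = j)
    (h2 : ∀ j, k + d < j → w j = j) :
    ∃ a : ℕ →₀ ℕ, (∀ i, a i = lCode w i) ∧ 0 < (pipeCoeff k d w).coeff a := by
  induction d generalizing k w with
  | zero =>
    rw [eq_one_of_fixes k w h1 h2]
    exact ⟨0, by simp [lCode_one], by simp [pipeCoeff_zero_one]⟩
  | succ d ih =>
    obtain ⟨c, hc1, -, hc3⟩ := exists_first_row k (d + 1) w h1 h2
    obtain ⟨w', h5, h6, h7, h8⟩ := hc3 (X k) d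
    obtain ⟨a, ha, hpos⟩ := ih (k + 1) w' h7 (fun j hj => h8 j (by omega))
    refine ⟨Finsupp.single k c + a, ?_, ?_⟩
    · intro i
      rw [h6, Finsupp.add_apply, ha, Finsupp.single_apply, add_comm]
      simp only [eq_comm]
    · obtain ⟨e, he⟩ := Nat.exists_eq_add_of_le hc1
      rw [pipeCoeff_succ, he, rowProd_add]
      refine lt_of_lt_of_le ?_ (coeff_le_coeff_rowProd k (k + c) e _
        (coeff_rowProd_nonneg k k c _ (pipeCoeff_nonneg (k + 1) d)) w _)
      rw [h5, X_pow_eq_monomial, coeff_monomial_mul, one_mul]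
      exact hpos

end LeadingTerm

section SchubertAuxEq

open Equiv MvPolynomial

/-- The pairs of positions below `n` that are not inversions of `w`. -/
def nonInversions (n : ℕ) (w : Perm ℕ) : Finset (ℕ × ℕ) :=
  (Finset.range n ×ˢ Finset.range n).filter fun p => p.1 < p.2 ∧ w p.1 < w p.2

theorem mem_nonInversions (n : ℕ) (w : Perm ℕ) (a b : ℕ) :
    (a, b) ∈ nonInversions n w ↔ (a < n ∧ b < n) ∧ a < b ∧ w a < w b := by
  simp [nonInversions]

theorem card_nonInversions_lt (n i : ℕ) (w : Perm ℕ) (hi : i + 1 < n) (hw : w i < w (i + 1)) :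
    (nonInversions n (w * swap i (i + 1))).card < (nonInversions n w).card := by
  have hinj : Function.Injective (Prod.map (swap i (i + 1)) (swap i (i + 1))) :=
    (swap i (i + 1)).injective.prodMap (swap i (i + 1)).injective
  rw [← Finset.card_image_of_injective _ hinj]
  apply Finset.card_lt_card
  rw [Finset.ssubset_iff_of_subset]
  · refine ⟨(i, i + 1), (mem_nonInversions ..).2 (by omega), ?_⟩
    simp only [Finset.mem_image, mem_nonInversions, Prod.exists, Prod.map_apply, Prod.mk.injEq,
      not_exists, not_and]
    rintro a b ⟨-, h1, -⟩ h2 h3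
    rw [← eq_symm_apply, symm_swap, swap_apply_left] at h2
    rw [← eq_symm_apply, symm_swap, swap_apply_right] at h3
    omega
  · intro p hp
    simp only [Finset.mem_image, mem_nonInversions, Prod.exists, Perm.mul_apply] at hp
    obtain ⟨a, b, ⟨⟨h1, h2⟩, h3, h4⟩, rfl⟩ := hp
    refine (mem_nonInversions ..).2 ⟨?_, ?_, h4⟩
    · simp only [swap_apply_def]; split_ifs <;> omega
    · by_contra h
      have : a = i ∧ b = i + 1 := by
        simp only [swap_apply_def] at h
        split_ifs at h <;> omega
      obtain ⟨rfl, rfl⟩ := this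
      simp only [swap_apply_left, swap_apply_right] at h4
      omega

theorem pipeCoeff_eq_staircase (n : ℕ) (w : Perm ℕ) (hw : InSymm n w)
    (h : ¬∃ i, i + 1 < n ∧ w i < w (i + 1)) : pipeCoeff 0 (n - 1) w = staircase n := by
  rcases n with _ | n
  · rw [eq_one_of_fixes 0 w (by simp) (fun j _ => hw j (Nat.zero_le _))]
    simp [staircase, pipeCoeff_zero_one]
  have hlt : ∀ i j, i < j → j < n + 1 → w j < w i := by
    intro i j hij hj
    induction j, hij using Nat.le_induction with
    | base =>
      have h1 : ¬ w i < w (i + 1) := fun h' => h ⟨i, hj, h'⟩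
      have h2 : w i ≠ w (i + 1) := fun h' => by have := w.injective h'; omega
      show w (i + 1) < w i
      omega
    | succ j hij ih =>
      have h1 : ¬ w j < w (j + 1) := fun h' => h ⟨j, hj, h'⟩
      have h2 : w j ≠ w (j + 1) := fun h' => by have := w.injective h'; omega
      have := ih (by omega)
      omega
  rw [Nat.add_sub_cancel, pipeCoeff_eq_prod 0 n w (by simp) (fun j hj => hw j (by omega)),
    staircase]
  · simp
  · intro i hi
    have hwi : w i < n + 1 := by
      by_contra! h'
      have := w.injective (hw _ h')
      omega
    have : {j | i < j ∧ w j < w i} = (Finset.Ioo i (n + 1) : Set ℕ) := by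
      ext j
      simp only [Set.mem_ofPred_eq, Finset.coe_Ioo, Set.mem_Ioo]
      refine ⟨fun ⟨h1, h2⟩ => ⟨h1, ?_⟩, fun ⟨h1, h2⟩ => ⟨h1, hlt i j h1 h2⟩⟩
      by_contra! h'
      have := hw j h'
      omega
    rw [zero_add, lCode, this, Set.ncard_coe_finset, Nat.card_Ioo]
    omega

theorem SchubertAux_eq_pipeCoeff (n k : ℕ) (w : Perm ℕ) (hw : InSymm n w)
    (hk : (nonInversions n w).card ≤ k) : SchubertAux n k w = pipeCoeff 0 (n - 1) w := by
  induction k generalizing w with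
  | zero =>
    refine (pipeCoeff_eq_staircase n w hw ?_).symm
    rintro ⟨i, hi, h⟩
    have := card_nonInversions_lt n i w hi h
    omega
  | succ k ih =>
    rw [SchubertAux]
    split_ifs with h
    · obtain ⟨h1, h2⟩ := h.choose_spec
      have := card_nonInversions_lt n _ w h1 h2
      rw [ih _ ?_ (by omega), divDiff_pipeCoeff _ _ (by omega) _ h2]
      intro m hm
      rw [Perm.mul_apply, swap_apply_of_ne_of_ne (by omega) (by omega), hw m hm]
    · exact (pipeCoeff_eq_staircase n w hw h).symm

theorem Schubert_eq_pipeCoeff (w : Perm ℕ) (hw : IsFinPerm w) :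
    ∃ n, InSymm n w ∧ Schubert w = pipeCoeff 0 (n - 1) w := by
  refine ⟨hw.choose, hw.choose_spec, ?_⟩
  rw [Schubert, dif_pos hw]
  refine SchubertAux_eq_pipeCoeff _ _ w hw.choose_spec ((Finset.card_filter_le _ _).trans ?_)
  simp

end SchubertAuxEq

section Support

open Equiv MvPolynomial

/-- Column `j` of the Rothe diagram, as a finite set of rows. -/
def rotheColFinset (w : Perm ℕ) (j : ℕ) : Finset ℕ :=
  (Finset.range (w.symm j)).filter fun r => j < w r

theorem mem_rotheColFinset {w : Perm ℕ} {j r : ℕ} :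
    r ∈ rotheColFinset w j ↔ r < w.symm j ∧ j < w r := by
  simp [rotheColFinset]

theorem le_of_mem_rotheColFinset {w : Perm ℕ} {j r k : ℕ} (hk : ∀ i < k, w i = i)
    (hr : r ∈ rotheColFinset w j) : k ≤ r := by
  rw [mem_rotheColFinset] at hr
  by_contra! h
  rw [hk r h] at hr
  have h1 : w.symm j = j := by rw [symm_apply_eq, hk j (by omega)]
  omega

theorem lt_of_mem_rotheColFinset {w : Perm ℕ} {j r n : ℕ} (hw : InSymm n w)
    (hr : r ∈ rotheColFinset w j) : r < n ∧ j < n := by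
  rw [mem_rotheColFinset] at hr
  have h1 : r < n := by
    by_contra! h
    rw [hw r h] at hr
    have h2 := hw (w.symm j) (by omega)
    rw [apply_symm_apply] at h2
    omega
  refine ⟨h1, ?_⟩
  by_contra! h
  have := w.injective (hw (w r) (by omega))
  omega

theorem rotheColFinset_of_swap (w : Perm ℕ) (b : ℕ) (h : w.symm (b + 1) < w.symm b) (j : ℕ) :
    rotheColFinset w j =
      if j = b then insert (w.symm (b + 1)) (rotheColFinset (swap b (b + 1) * w) (b + 1))
      else if j = b + 1 then rotheColFinset (swap b (b + 1) * w) b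
      else rotheColFinset (swap b (b + 1) * w) j := by
  obtain ⟨p, hp⟩ : ∃ p, w.symm (b + 1) = p := ⟨_, rfl⟩
  obtain ⟨q, hq⟩ : ∃ q, w.symm b = q := ⟨_, rfl⟩
  rw [hp, hq] at h
  have hp' := (symm_apply_eq _).1 hp
  have hq' := (symm_apply_eq _).1 hq
  have h1 : ∀ x, w x = b ↔ x = q := fun x => by rw [hq']; exact w.apply_eq_iff_eq
  have h2 : ∀ x, w x = b + 1 ↔ x = p := fun x => by rw [hp']; exact w.apply_eq_iff_eq
  ext r
  have h5 := h1 r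
  have h6 := h2 r
  split_ifs with h3 h4
  · subst h3
    simp only [mem_rotheColFinset, Finset.mem_insert, symm_swap_mul, swap_apply_right, hp, hq,
      Perm.mul_apply]
    simp only [swap_apply_def]
    split_ifs <;> omega
  · subst h4
    simp only [mem_rotheColFinset, symm_swap_mul, swap_apply_left, hp, Perm.mul_apply]
    simp only [swap_apply_def]
    split_ifs <;> omega
  · simp only [mem_rotheColFinset, symm_swap_mul, swap_apply_of_ne_of_ne h3 h4, Perm.mul_apply]
    simp only [swap_apply_def]
    split_ifs <;> omega

/-- The finite set `E` is componentwise at most `C`. -/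
def ColumnLE (E C : Finset ℕ) : Prop :=
  E.card = C.card ∧ ∀ t, (C.filter (· < t)).card ≤ (E.filter (· < t)).card

theorem ColumnLE.insert {E C : Finset ℕ} {k p : ℕ} (h : ColumnLE E C) (hk : k ∉ E) (hp : p ∉ C)
    (hkp : k ≤ p) (hC : ∀ r ∈ C, k ≤ r) : ColumnLE (insert k E) (insert p C) := by
  refine ⟨by rw [Finset.card_insert_of_notMem hk, Finset.card_insert_of_notMem hp, h.1],
    fun t => ?_⟩
  rcases le_or_gt t k with ht | ht
  · have : (Insert.insert p C).filter (· < t) = ∅ := by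
      rw [Finset.filter_eq_empty_iff]
      intro r hr
      rw [Finset.mem_insert] at hr
      rcases hr with rfl | hr
      · omega
      · have := hC r hr
        omega
    simp [this]
  · have h1 : ((Insert.insert k E).filter (· < t)).card = (E.filter (· < t)).card + 1 := by
      rw [Finset.filter_insert, if_pos ht, Finset.card_insert_of_notMem (by simp [hk])]
    rw [h1, Finset.filter_insert]
    split_ifs
    · exact (Finset.card_insert_le _ _).trans (Nat.succ_le_succ (h.2 t))
    · exact (h.2 t).trans (Nat.le_succ _)

/-- The content of a family of columns. -/
noncomputable def content (n : ℕ) (E : ℕ → Finset ℕ) : ℕ →₀ ℕ :=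
  ∑ j ∈ Finset.range n, ∑ e ∈ E j, Finsupp.single e 1

/-- The columns obtained from `E` by exchanging columns `b` and `b + 1` and then adding an entry
`k` to column `b`. -/
def addEntry (k b : ℕ) (E : ℕ → Finset ℕ) (j : ℕ) : Finset ℕ :=
  if j = b then insert k (E (b + 1)) else if j = b + 1 then E b else E j

theorem content_addEntry (n k b : ℕ) (E : ℕ → Finset ℕ) (hb : b + 1 < n) (hk : k ∉ E (b + 1)) :
    content n (addEntry k b E) = Finsupp.single k 1 + content n E := by
  have h1 : ∀ j, ∑ e ∈ addEntry k b E j, (Finsupp.single e 1 : ℕ →₀ ℕ) =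
      (if j = b then Finsupp.single k 1 else 0) +
        ∑ e ∈ E (swap b (b + 1) j), Finsupp.single e 1 := by
    intro j
    unfold addEntry
    split_ifs with h2 h3
    · rw [h2, swap_apply_left, Finset.sum_insert hk]
    · rw [h3, swap_apply_right, zero_add]
    · rw [swap_apply_of_ne_of_ne h2 h3, zero_add]
  rw [content, Finset.sum_congr rfl fun j _ => h1 j, Finset.sum_add_distrib,
    Finset.sum_ite_eq' (Finset.range n) b, if_pos (Finset.mem_range.2 (by omega)), content]
  congr 1
  refine Finset.sum_equiv (swap b (b + 1)) ?_ (fun _ _ => rfl)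
  intro j
  simp only [Finset.mem_range, swap_apply_def]
  split_ifs <;> omega

/-- `a` is the content of columns bounded by those of the Rothe diagram of `w`, with entries at
least `k`, and with `k` appearing only in columns before `b`. -/
def HasColumns (n k b : ℕ) (w : Perm ℕ) (a : ℕ →₀ ℕ) : Prop :=
  (∀ j < k, w j = j) ∧ ∃ E : ℕ → Finset ℕ, (∀ j, ColumnLE (E j) (rotheColFinset w j)) ∧
    (∀ j, ∀ e ∈ E j, k ≤ e ∧ (e = k → j < b)) ∧ a = content n E

theorem HasColumns.of_swap {n k b : ℕ} {w : Perm ℕ} {a : ℕ →₀ ℕ}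
    (h : HasColumns n k b (swap b (b + 1) * w) a) (hkb : k ≤ b) (hb : b + 1 < n)
    (hw : w.symm (b + 1) < w.symm b) : HasColumns n k (b + 1) w (Finsupp.single k 1 + a) := by
  obtain ⟨h1, E, h2, h3, rfl⟩ := h
  have hk : k ∉ E (b + 1) := fun hk => by
    have := (h3 _ _ hk).2 rfl
    omega
  have hfix : ∀ j < k, w j = j := by
    intro j hj
    have := h1 j hj
    rw [Perm.mul_apply, ← eq_symm_apply, symm_swap,
      swap_apply_of_ne_of_ne (by omega) (by omega)] at this
    exact this
  refine ⟨hfix, addEntry k b E, fun j => ?_, fun j e => ?_, (content_addEntry n k b E hb hk).symm⟩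
  · rw [rotheColFinset_of_swap w b hw, addEntry]
    split_ifs
    · refine (h2 (b + 1)).insert hk ?_ ?_ fun r hr => le_of_mem_rotheColFinset h1 hr
      · simp [mem_rotheColFinset]
      · by_contra! h
        have := hfix _ h
        rw [apply_symm_apply] at this
        omega
    · exact h2 b
    · exact h2 j
  · unfold addEntry
    split_ifs with h4 h5
    · rw [Finset.mem_insert]
      rintro (rfl | he)
      · omega
      · have := h3 _ _ he
        omega
    · intro he
      have := h3 _ _ he
      omega
    · intro he
      have := h3 _ _ he
      omega

theorem hasColumns_pipeCoeff (n k d : ℕ) (hn : k + d < n) (w : Perm ℕ) (a : ℕ →₀ ℕ)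
    (ha : a ∈ (pipeCoeff k d w).support) : HasColumns n k (k + d) w a := by
  induction d generalizing k w a with
  | zero =>
    have hw : w = 1 := by
      by_contra h
      rw [show pipeCoeff k 0 w = 0 from if_neg h] at ha
      simp at ha
    subst hw
    rw [pipeCoeff_zero_one] at ha
    obtain rfl : a = 0 := by
      by_contra h
      rw [mem_support_iff, coeff_one, if_neg (Ne.symm h)] at ha
      exact ha rfl
    refine ⟨fun _ _ => rfl, fun _ => ∅, fun j => ?_, by simp, by simp [content]⟩
    have : rotheColFinset 1 j = ∅ := by
      ext r
      simp [mem_rotheColFinset, ← Perm.inv_def]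
      omega
    simp [this, ColumnLE]
  | succ d ih =>
    refine rowProd_induction (fun b g => ∀ (w : Perm ℕ) (a : ℕ →₀ ℕ), a ∈ (g w).support →
      HasColumns n k b w a) k (d + 1) (X k) ?_ (pipeCoeff (k + 1) d) ?_ w a ha
    · intro b h1 h2 g hg w a ha
      rcases Finset.mem_union.1 (support_add ha) with ha | ha
      · obtain ⟨h3, E, h4, h5, h6⟩ := hg w a ha
        exact ⟨h3, E, h4, fun j e he => ⟨(h5 j e he).1, fun h => (h5 j e he).2 h |>.trans
          (Nat.lt_succ_self b)⟩, h6⟩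
      · rw [Pi.smul_apply, smul_eq_mul, support_X_mul, Finset.mem_map] at ha
        obtain ⟨a, hab, rfl⟩ := ha
        rw [leftOp_apply] at hab
        split_ifs at hab with h3
        · exact (hg _ _ hab).of_swap h1 (by omega) h3
        · simp at hab
    · intro w a ha
      obtain ⟨h3, E, h4, h5, h6⟩ := ih (k + 1) (by omega) w a ha
      refine ⟨fun j hj => h3 j (by omega), E, h4, fun j e he => ?_, h6⟩
      have := h5 j e he
      omega

theorem content_apply (n : ℕ) (E : ℕ → Finset ℕ) (hE : ∀ j, n ≤ j → E j = ∅) (i : ℕ) :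
    content n E i = {j | i ∈ E j}.ncard := by
  have h1 : {j | i ∈ E j} = ((Finset.range n).filter fun j => i ∈ E j : Finset ℕ) := by
    ext j
    simp only [Set.mem_ofPred_eq, Finset.coe_filter, Finset.mem_range]
    refine ⟨fun h => ⟨?_, h⟩, fun h => h.2⟩
    by_contra! h2
    simp [hE j h2] at h
  rw [h1, Set.ncard_coe_finset, Finset.card_filter, content, Finsupp.finsetSum_apply]
  refine Finset.sum_congr rfl fun j _ => ?_
  simp [Finsupp.finsetSum_apply, Finsupp.single_apply]

theorem exists_columns_of_mem_support_Schubert (w : Perm ℕ) (hw : IsFinPerm w) (a : ℕ →₀ ℕ)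
    (ha : a ∈ (Schubert w).support) :
    ∃ E : ℕ → Finset ℕ, (∀ j, ColumnLE (E j) (rotheColFinset w j)) ∧
      ∀ i, a i = {j | i ∈ E j}.ncard := by
  obtain ⟨n, hn, h⟩ := Schubert_eq_pipeCoeff w hw
  rw [h] at ha
  obtain ⟨-, E, h1, -, rfl⟩ := hasColumns_pipeCoeff (n - 1 + 1) 0 (n - 1) (by omega) w a ha
  refine ⟨E, h1, content_apply _ E fun j hj => ?_⟩
  rw [← Finset.card_eq_zero, (h1 j).1, Finset.card_eq_zero, Finset.eq_empty_iff_forall_notMem]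
  intro r hr
  have := lt_of_mem_rotheColFinset hn hr
  omega

theorem Schubert_coeff_nonneg (w : Perm ℕ) (hw : IsFinPerm w) (a : ℕ →₀ ℕ) :
    0 ≤ (Schubert w).coeff a := by
  obtain ⟨n, -, h⟩ := Schubert_eq_pipeCoeff w hw
  rw [h]
  exact pipeCoeff_nonneg _ _ _ _

theorem exists_Schubert_coeff_lCode_pos (w : Perm ℕ) (hw : IsFinPerm w) :
    ∃ a : ℕ →₀ ℕ, (∀ i, a i = lCode w i) ∧ 0 < (Schubert w).coeff a := by
  obtain ⟨n, hn, h⟩ := Schubert_eq_pipeCoeff w hw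
  rw [h]
  exact exists_coeff_lCode_pos 0 (n - 1) w (by simp) fun j hj => hn j (by omega)

theorem exists_add_eq_lCode (u v w : Perm ℕ) (c : Perm ℕ →₀ ℕ) (hw : IsFinPerm w)
    (hc : IsSchubertCoeff u v c) (hcw : c w ≠ 0) :
    ∃ a ∈ (Schubert u).support, ∃ b ∈ (Schubert v).support, ∀ i, (a + b) i = lCode w i := by
  obtain ⟨α, hα, hpos⟩ := exists_Schubert_coeff_lCode_pos w hw
  have h1 : ∀ x, ((c x : MvPolynomial ℕ ℤ) * Schubert x).coeff α =
      c x * (Schubert x).coeff α := by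
    intro x
    rw [← nsmul_eq_mul, coeff_smul, nsmul_eq_mul]
  have h2 : 0 < (Schubert u * Schubert v).coeff α := by
    rw [hc.2, Finsupp.sum, coeff_sum]
    refine Finset.sum_pos' (fun x hx => ?_) ⟨w, Finsupp.mem_support_iff.2 hcw, ?_⟩
    · rw [h1]
      exact mul_nonneg (Nat.cast_nonneg _) (Schubert_coeff_nonneg x (hc.1 x hx) α)
    · rw [h1]
      exact mul_pos (Nat.cast_pos.2 (Nat.pos_of_ne_zero hcw)) hpos
  have h3 := support_mul _ _ (mem_support_iff.2 h2.ne')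
  obtain ⟨a, ha, b, hb, hab⟩ := Finset.mem_add.1 h3
  exact ⟨a, ha, b, hb, fun i => by rw [hab, hα]⟩

theorem ColumnLE.exists_filling {E C : Finset ℕ} (h : ColumnLE E C) :
    ∃ f : ℕ → ℕ, StrictMonoOn f C ∧ (∀ r ∈ C, f r ≤ r) ∧ C.image f = E := by
  have hfin : (Set.ofPred (· ∈ E)).Finite := E.finite_toSet
  have hcard : hfin.toFinset.card = E.card := by
    congr 1
    ext x
    rw [Set.Finite.mem_toFinset]
    rfl
  have hlt : ∀ r ∈ C, (C.filter (· < r)).card < hfin.toFinset.card := by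
    intro r hr
    rw [hcard, h.1]
    refine Finset.card_lt_card ((Finset.filter_ssubset).2 ⟨r, hr, lt_irrefl r⟩)
  have hmono : StrictMonoOn (fun r => Nat.nth (· ∈ E) (C.filter (· < r)).card) C := by
    intro r hr s hs hrs
    refine Nat.nth_strictMonoOn hfin (hlt r hr) (hlt s hs) (Finset.card_lt_card ?_)
    rw [Finset.ssubset_iff_of_subset]
    · exact ⟨r, by simpa using ⟨hr, hrs⟩, by simp⟩
    · intro t
      simp only [Finset.mem_filter]
      exact fun ht => ⟨ht.1, ht.2.trans hrs⟩
  refine ⟨_, hmono, fun r hr => ?_, ?_⟩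
  · refine Nat.lt_succ_iff.1 (Nat.nth_lt_of_lt_count ?_)
    rw [Nat.count_eq_card_filter_range]
    have h1 : (C.filter (· < r)).card < (C.filter (· < r + 1)).card := by
      apply Finset.card_lt_card
      rw [Finset.ssubset_iff_of_subset]
      · exact ⟨r, by simpa using hr, by simp⟩
      · intro t
        simp only [Finset.mem_filter]
        exact fun ht => ⟨ht.1, ht.2.trans (Nat.lt_succ_self r)⟩
    refine (h1.trans_le (h.2 (r + 1))).trans_eq (congrArg Finset.card ?_)
    ext t
    simp [and_comm]
  · apply Finset.eq_of_subset_of_card_le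
    · intro e he
      obtain ⟨r, hr, rfl⟩ := Finset.mem_image.1 he
      exact Nat.nth_mem_of_lt_card hfin (hlt r hr)
    · rw [Finset.card_image_of_injOn hmono.injOn, h.1]

theorem mem_doubleDiagram {n : ℕ} {u v : Perm ℕ} (hu : InSymm n u) (q : ℕ × ℕ) :
    q ∈ doubleDiagram n u v ↔
      q.1 ∈ if q.2 < n then rotheColFinset u q.2 else rotheColFinset v (q.2 - n) := by
  obtain ⟨r, h⟩ := q
  have h1 : (r, h) ∈ rothe u ↔ r ∈ rotheColFinset u h := by
    rw [mem_rotheColFinset, and_comm]; rfl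
  have h2 : ∀ j, (r, j) ∈ rothe v ↔ r ∈ rotheColFinset v j := by
    intro j
    rw [mem_rotheColFinset, and_comm]; rfl
  simp only [doubleDiagram, Set.mem_union, Set.mem_ofPred_eq, h1, Prod.exists, Prod.mk.injEq]
  split_ifs with hh
  · refine ⟨?_, Or.inl⟩
    rintro (h3 | ⟨r, j, -, -, rfl⟩)
    · exact h3
    · omega
  · rw [← h2]
    constructor
    · rintro (h3 | ⟨r, j, h3, rfl, rfl⟩)
      · exact absurd (lt_of_mem_rotheColFinset hu h3).2 hh
      · simpa using h3
    · intro h3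
      exact Or.inr ⟨r, h - n, h3, rfl, by omega⟩

theorem exists_isIndicatorTableau {n : ℕ} {u v w : Perm ℕ} (hu : InSymm n u) (hv : InSymm n v)
    {A B : ℕ → Finset ℕ} (hA : ∀ j, ColumnLE (A j) (rotheColFinset u j))
    (hB : ∀ j, ColumnLE (B j) (rotheColFinset v j))
    (hcont : ∀ i, {j | i ∈ A j}.ncard + {j | i ∈ B j}.ncard = lCode w i) :
    ∃ T, IsIndicatorTableau n u v w T := by
  have hempty : ∀ {x : Perm ℕ} {E : ℕ → Finset ℕ}, InSymm n x →
      (∀ j, ColumnLE (E j) (rotheColFinset x j)) → ∀ i j, i ∈ E j → j < n := by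
    intro x E hx hE i j hi
    have h1 : 0 < (E j).card := Finset.card_pos.2 ⟨i, hi⟩
    rw [(hE j).1, Finset.card_pos] at h1
    obtain ⟨r, hr⟩ := h1
    exact (lt_of_mem_rotheColFinset hx hr).2
  set D : ℕ → Finset ℕ := fun h =>
    if h < n then rotheColFinset u h else rotheColFinset v (h - n) with hD
  set E : ℕ → Finset ℕ := fun h => if h < n then A h else B (h - n) with hE
  have hmem : ∀ q, q ∈ doubleDiagram n u v ↔ q.1 ∈ D q.2 := mem_doubleDiagram hu
  have hED : ∀ h, ColumnLE (E h) (D h) := by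
    intro h
    simp only [hD, hE]
    split_ifs
    · exact hA h
    · exact hB _
  have hDn : ∀ h r, r ∈ D h → r < n := by
    intro h r
    simp only [hD]
    split_ifs
    · exact fun hr => (lt_of_mem_rotheColFinset hu hr).1
    · exact fun hr => (lt_of_mem_rotheColFinset hv hr).1
  choose F hF1 hF2 hF3 using fun h => (hED h).exists_filling
  refine ⟨fun q => F q.2 q.1, ?_, ?_, ?_, ?_⟩
  · intro p hp
    rw [hmem] at hp
    exact (hF2 _ _ hp).trans_lt (hDn _ _ hp)
  · intro i _
    have h1 : Set.InjOn Prod.snd {p : ℕ × ℕ | p ∈ doubleDiagram n u v ∧ F p.2 p.1 = i} := by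
      rintro ⟨r, h⟩ ⟨hp1, hp2⟩ ⟨s, h'⟩ ⟨hq1, hq2⟩ (rfl : h = h')
      rw [hmem] at hp1 hq1
      exact congrArg (·, h) ((hF1 h).injOn hp1 hq1 (hp2.trans hq2.symm))
    have h2 : Prod.snd '' {p : ℕ × ℕ | p ∈ doubleDiagram n u v ∧ F p.2 p.1 = i} =
        {j | i ∈ A j} ∪ (· + n) '' {j | i ∈ B j} := by
      have h3 : Prod.snd '' {p : ℕ × ℕ | p ∈ doubleDiagram n u v ∧ F p.2 p.1 = i} =
          {h | i ∈ E h} := by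
        ext h
        simp only [Set.mem_image, Set.mem_ofPred_eq, Prod.exists, exists_eq_right, hmem]
        rw [← hF3 h, Finset.mem_image]
      rw [h3]
      ext h
      simp only [Set.mem_ofPred_eq, Set.mem_union, Set.mem_image, hE]
      split_ifs with hh
      · refine ⟨Or.inl, ?_⟩
        rintro (h4 | ⟨j, -, rfl⟩)
        · exact h4
        · omega
      · constructor
        · exact fun h4 => Or.inr ⟨h - n, h4, by omega⟩
        · rintro (h4 | ⟨j, h4, rfl⟩)
          · exact absurd (hempty hu hA _ _ h4) hh
          · simpa using h4
    have hfA : {j | i ∈ A j}.Finite :=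
      (Set.finite_Iio n).subset fun j hj => hempty hu hA _ _ hj
    have hfB : {j | i ∈ B j}.Finite :=
      (Set.finite_Iio n).subset fun j hj => hempty hv hB _ _ hj
    rw [← h1.ncard_image, h2, Set.ncard_union_eq ?_ hfA (hfB.image _),
      Set.ncard_image_of_injective _ (add_left_injective n), hcont]
    rw [Set.disjoint_left]
    rintro j hj ⟨j', -, rfl⟩
    have : j' + n < n := hempty hu hA _ _ hj
    omega
  · rintro ⟨r, h⟩ hp ⟨s, h'⟩ hq (rfl : h = h') hrs
    rw [hmem] at hp hq
    exact hF1 h hp hq hrs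
  · intro p hp
    rw [hmem] at hp
    exact hF2 _ _ hp

end Support

/-- St. Dizier–Yong vanishing condition: if `Tab^w_{u,v} = ∅` then `c^w_{u,v} = 0`. -/
theorem stDizier_yong_vanishing
    (n : ℕ) (u v w : Equiv.Perm ℕ) (hu : InSymm n u) (hv : InSymm n v) (hw : InSymm n w)
    (hTab : ¬ ∃ T : ℕ × ℕ → ℕ, IsIndicatorTableau n u v w T) :
    ∀ c : Equiv.Perm ℕ →₀ ℕ, IsSchubertCoeff u v c → c w = 0 := by
  intro c hc
  by_contra hcw
  obtain ⟨a, ha, b, hb, hab⟩ := exists_add_eq_lCode u v w c ⟨n, hw⟩ hc hcw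
  obtain ⟨A, hA, hA'⟩ := exists_columns_of_mem_support_Schubert u ⟨n, hu⟩ a ha
  obtain ⟨B, hB, hB'⟩ := exists_columns_of_mem_support_Schubert v ⟨n, hv⟩ b hb
  refine hTab (exists_isIndicatorTableau hu hv hA hB fun i => ?_)
  rw [← hA', ← hB', ← hab, Finsupp.add_apply]
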